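/- arXiv:1505.07217 — 3 statements merged into one kernel-verified Lean document; each statement's English description precedes it below -/
import Mathlib

section
/- For every integer n ≥ 3, the number y_n is positive and is the unique positive real root of the equation y·(y + 6(n−1))² = ((n² − 4n + 6)/(n² − 4))²·(y + 4(n−1))³; that is, y_n satisfies this equation, and any y > 0 satisfying it equals y_n. -/
open Real Filter

noncomputable def alphaF (n : ℕ) (c : ℝ) (x : ℝ) : ℝ :=
  (n : ℝ) * c + ((n : ℝ) / (2 * ((n : ℝ) - 1))) * x
    - (((n : ℝ) - 2) / (2 * ((n : ℝ) - 1))) * Real.sqrt (x ^ 2 + 4 * ((n : ℝ) - 1) * c * x)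

noncomputable def yn (n : ℕ) : ℝ :=
  4 * (1 - (n : ℝ)) + (2 * ((n : ℝ) ^ 2 - 4) / Real.sqrt (2 * (n : ℝ) - 5)) *
    Real.cos ((1 / 3) * Real.arctan (((n : ℝ) ^ 2 - 4 * (n : ℝ) + 6) /
      (2 * ((n : ℝ) - 1) * Real.sqrt (2 * (n : ℝ) - 5))))

noncomputable def x0 (n : ℕ) (c : ℝ) : ℝ := yn n * c

noncomputable def betaF (n : ℕ) (c : ℝ) (x : ℝ) : ℝ :=
  alphaF n c (x0 n c) + deriv (alphaF n c) (x0 n c) * (x - x0 n c)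
    + (1 / 2) * deriv (deriv (alphaF n c)) (x0 n c) * (x - x0 n c) ^ 2

noncomputable def gammaF (n : ℕ) (c : ℝ) (x : ℝ) : ℝ :=
  if x0 n c ≤ x then alphaF n c x else betaF n c x

noncomputable def gammaF' (n : ℕ) (c : ℝ) (x : ℝ) : ℝ :=
  derivWithin (gammaF n c) (Set.Ici 0) x

noncomputable def gammaF'' (n : ℕ) (c : ℝ) (x : ℝ) : ℝ :=
  derivWithin (gammaF' n c) (Set.Ici 0) x

noncomputable def omegaF (n : ℕ) (c : ℝ) (x : ℝ) : ℝ :=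
  (x ^ 2 / Real.sqrt (x ^ 2 + 4 * ((n : ℝ) - 1) * c * x)) *
    ((1 + (n : ℝ) ^ 2 * c / x) *
      (((n : ℝ) / ((n : ℝ) - 2) - (1 + 4 * ((n : ℝ) - 1) * c / x) ^ (-(1 / 2) : ℝ)) /
       ((n : ℝ) / ((n : ℝ) - 2) + (1 + 4 * ((n : ℝ) - 1) * c / x) ^ (-(1 / 2) : ℝ)))) ^ 2

theorem cos_arctan_div_of_sq_add_sq {a b c : ℝ} (hb : 0 < b) (hc : 0 < c)
    (h : a ^ 2 + b ^ 2 = c ^ 2) : Real.cos (Real.arctan (a / b)) = b / c := by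
  have hsq : 1 + (a / b) ^ 2 = (c / b) ^ 2 := by
    field_simp
    linarith
  rw [Real.cos_arctan, hsq, Real.sqrt_sq (by positivity), one_div_div]

theorem cos_one_third_mul_arctan_pos (x : ℝ) : 0 < Real.cos ((1 / 3) * Real.arctan x) := by
  have h₁ := Real.arctan_lt_pi_div_two x
  have h₂ := Real.neg_pi_div_two_lt_arctan x
  have h₃ := Real.pi_pos
  exact Real.cos_pos_of_mem_Ioo ⟨by linarith, by linarith⟩

theorem cubic_cos_one_third (x : ℝ) :
    4 * Real.cos ((1 / 3) * x) ^ 3 - 3 * Real.cos ((1 / 3) * x) = Real.cos x := by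
  rw [← Real.cos_three_mul]
  congr 1
  ring

theorem mul_sq_eq_mul_cube_unique {m k y w : ℝ} (hm : 0 < m) (hy : 0 < y) (hw : 0 < w)
    (hy' : y * (y + 6 * m) ^ 2 = k * (y + 4 * m) ^ 3)
    (hw' : w * (w + 6 * m) ^ 2 = k * (w + 4 * m) ^ 3) : y = w := by
  obtain ⟨u, hu⟩ : ∃ u, u = y + 4 * m := ⟨_, rfl⟩
  obtain ⟨v, hv⟩ : ∃ v, v = w + 4 * m := ⟨_, rfl⟩
  have hu0 : 0 < u := by linarith
  have hv0 : 0 < v := by linarith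
  obtain rfl : y = u - 4 * m := by linarith
  obtain rfl : w = v - 4 * m := by linarith
  have hprod : (u - v) * (3 * u * v * (u + v) + 4 * m * (u ^ 2 + u * v + v ^ 2)) * (4 * m ^ 2)
      = 0 := by
    linear_combination v ^ 3 * hy' - u ^ 3 * hw'
  have hpos : 0 < 3 * u * v * (u + v) + 4 * m * (u ^ 2 + u * v + v ^ 2) := by positivity
  have hm2 : 4 * m ^ 2 ≠ 0 := by positivity
  have : u - v = 0 := by simpa [hpos.ne', hm2, hm.ne'] using hprod
  linarith

theorem yn_add_pos {n : ℕ} (hn : 3 ≤ n) : 0 < yn n + 4 * ((n : ℝ) - 1) := by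
  have hn' : (3 : ℝ) ≤ n := by exact_mod_cast hn
  have hB : 0 < (n : ℝ) ^ 2 - 4 := by nlinarith
  have hs : 0 < √(2 * (n : ℝ) - 5) := Real.sqrt_pos.2 (by linarith)
  have hC := cos_one_third_mul_arctan_pos
    (((n : ℝ) ^ 2 - 4 * (n : ℝ) + 6) / (2 * ((n : ℝ) - 1) * √(2 * (n : ℝ) - 5)))
  have : 0 < (2 * ((n : ℝ) ^ 2 - 4) / √(2 * (n : ℝ) - 5)) *
      Real.cos ((1 / 3) * Real.arctan (((n : ℝ) ^ 2 - 4 * (n : ℝ) + 6) /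
        (2 * ((n : ℝ) - 1) * √(2 * (n : ℝ) - 5)))) := by positivity
  rw [yn]
  linarith

theorem yn_equation {n : ℕ} (hn : 3 ≤ n) :
    yn n * (yn n + 6 * ((n : ℝ) - 1)) ^ 2 =
      (((n : ℝ) ^ 2 - 4 * (n : ℝ) + 6) / ((n : ℝ) ^ 2 - 4)) ^ 2 *
        (yn n + 4 * ((n : ℝ) - 1)) ^ 3 := by
  have hn' : (3 : ℝ) ≤ n := by exact_mod_cast hn
  rw [yn]
  generalize (n : ℝ) = x at hn' ⊢
  have hB : 0 < x ^ 2 - 4 := by nlinarith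
  have hm : 0 < x - 1 := by linarith
  have hs : 0 < √(2 * x - 5) := Real.sqrt_pos.2 (by linarith)
  have hs2 : √(2 * x - 5) ^ 2 = 2 * x - 5 := Real.sq_sqrt (by linarith)
  generalize √(2 * x - 5) = s at hs hs2 ⊢
  have hpyth : (x ^ 2 - 4 * x + 6) ^ 2 + (2 * (x - 1) * s) ^ 2 = (x ^ 2 - 4) ^ 2 := by
    linear_combination 4 * (x - 1) ^ 2 * hs2
  have hcub := cubic_cos_one_third (Real.arctan ((x ^ 2 - 4 * x + 6) / (2 * (x - 1) * s)))
  rw [cos_arctan_div_of_sq_add_sq (by positivity) hB hpyth] at hcub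
  generalize Real.cos _ = C at hcub ⊢
  generalize x ^ 2 - 4 = B at *
  generalize x ^ 2 - 4 * x + 6 = A at *
  obtain ⟨m, rfl⟩ : ∃ m, x = m + 1 := ⟨x - 1, by ring⟩
  simp only [add_sub_cancel_right] at *
  have hk : (A / B) ^ 2 = 1 - (2 * m * s / B) ^ 2 := by
    field_simp
    linarith
  rw [hk]
  field_simp at hcub ⊢
  linear_combination (8 * m ^ 2 * s ^ 2 * B ^ 2) * hcub

theorem stmt_2 (n : ℕ) (hn : 3 ≤ n) :
    0 < yn n ∧
    yn n * (yn n + 6 * ((n : ℝ) - 1)) ^ 2 =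
      (((n : ℝ) ^ 2 - 4 * (n : ℝ) + 6) / ((n : ℝ) ^ 2 - 4)) ^ 2 *
        (yn n + 4 * ((n : ℝ) - 1)) ^ 3 ∧
    ∀ y : ℝ, 0 < y →
      y * (y + 6 * ((n : ℝ) - 1)) ^ 2 =
        (((n : ℝ) ^ 2 - 4 * (n : ℝ) + 6) / ((n : ℝ) ^ 2 - 4)) ^ 2 *
          (y + 4 * ((n : ℝ) - 1)) ^ 3 →
      y = yn n := by
  have hn' : (3 : ℝ) ≤ n := by exact_mod_cast hn
  have hm : 0 < (n : ℝ) - 1 := by linarith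
  have hz := yn_add_pos hn
  have heq := yn_equation hn
  have hA : 0 < (n : ℝ) ^ 2 - 4 * (n : ℝ) + 6 := by nlinarith
  have hB : 0 < (n : ℝ) ^ 2 - 4 := by nlinarith
  have hpos : 0 < yn n := by
    refine pos_of_mul_pos_left ?_ (sq_nonneg (yn n + 6 * ((n : ℝ) - 1)))
    rw [heq]
    positivity
  exact ⟨hpos, heq, fun y hy h => mul_sq_eq_mul_cube_unique hm hy hpos h heq⟩
end

section
/- For every integer n ≥ 3, every real c > 0 and every x ≥ 0, one has 2x·γ''(x) + γ'(x) ≤ 3/(n+2), and equality holds if and only if x = x₀. -/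
open Real Filter

open Set Topology

theorem hasDerivAt_ite_le {f g f' g' : ℝ → ℝ} {a : ℝ}
    (hf : ∀ x, a ≤ x → HasDerivAt f (f' x) x) (hg : ∀ x, x ≤ a → HasDerivAt g (g' x) x)
    (hfg : f a = g a) (hfg' : f' a = g' a) (x : ℝ) :
    HasDerivAt (fun y => if a ≤ y then f y else g y) (if a ≤ x then f' x else g' x) x := by
  rcases lt_trichotomy x a with h | rfl | h
  · rw [if_neg h.not_ge]
    refine (hg x h.le).congr_of_eventuallyEq ?_
    filter_upwards [Iio_mem_nhds h] with y hy
    exact if_neg (not_le.mpr hy)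
  · rw [if_pos le_rfl, ← hasDerivWithinAt_univ, ← Iic_union_Ici (a := x)]
    refine HasDerivWithinAt.union ?_ ?_
    · rw [hfg']
      refine (hg x le_rfl).hasDerivWithinAt.congr (fun y hy => ?_) (by simp [hfg])
      rcases eq_or_lt_of_le (show y ≤ x from hy) with rfl | h
      · simp [hfg]
      · exact if_neg h.not_ge
    · exact (hf x le_rfl).hasDerivWithinAt.congr (fun y hy => if_pos hy) (by simp)
  · rw [if_pos h.le]
    refine (hf x h.le).congr_of_eventuallyEq ?_
    filter_upwards [Ioi_mem_nhds h] with y hy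
    exact if_pos (le_of_lt hy)

/-- The closed form of the derivative of `α` on the positive half-line. -/
noncomputable def alphaD (n : ℕ) (c x : ℝ) : ℝ :=
  (n : ℝ) / (2 * ((n : ℝ) - 1)) - (((n : ℝ) - 2) / (2 * ((n : ℝ) - 1))) *
    ((x + 2 * ((n : ℝ) - 1) * c) / √(x ^ 2 + 4 * ((n : ℝ) - 1) * c * x))

/-- The closed form of the second derivative of `α` on the positive half-line. -/
noncomputable def alphaD2 (n : ℕ) (c x : ℝ) : ℝ :=
  (((n : ℝ) - 2) / (2 * ((n : ℝ) - 1))) *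
    (4 * ((n : ℝ) - 1) ^ 2 * c ^ 2 / √(x ^ 2 + 4 * ((n : ℝ) - 1) * c * x) ^ 3)

theorem radicand_pos {n : ℕ} (hn : 3 ≤ n) {c x : ℝ} (hc : 0 < c) (hx : 0 < x) :
    0 < x ^ 2 + 4 * ((n : ℝ) - 1) * c * x := by
  have : (0 : ℝ) < (n : ℝ) - 1 := by
    have : (3 : ℝ) ≤ n := by exact_mod_cast hn
    linarith
  positivity

theorem hasDerivAt_sqrt_radicand {n : ℕ} (hn : 3 ≤ n) {c x : ℝ} (hc : 0 < c) (hx : 0 < x) :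
    HasDerivAt (fun y => √(y ^ 2 + 4 * ((n : ℝ) - 1) * c * y))
      ((x + 2 * ((n : ℝ) - 1) * c) / √(x ^ 2 + 4 * ((n : ℝ) - 1) * c * x)) x := by
  have h := radicand_pos hn hc hx
  have h1 : HasDerivAt (fun y => y ^ 2 + 4 * ((n : ℝ) - 1) * c * y)
      (2 * x + 4 * ((n : ℝ) - 1) * c) x := by
    simpa using (hasDerivAt_pow 2 x).fun_add
      ((hasDerivAt_id' x).const_mul (4 * ((n : ℝ) - 1) * c))
  convert h1.sqrt h.ne' using 1
  have := (Real.sqrt_pos.mpr h).ne'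
  field_simp
  ring

theorem hasDerivAt_alphaF {n : ℕ} (hn : 3 ≤ n) {c x : ℝ} (hc : 0 < c) (hx : 0 < x) :
    HasDerivAt (alphaF n c) (alphaD n c x) x := by
  have h := (((hasDerivAt_id x).const_mul ((n : ℝ) / (2 * ((n : ℝ) - 1)))).const_add
    ((n : ℝ) * c)).sub ((hasDerivAt_sqrt_radicand hn hc hx).const_mul
      (((n : ℝ) - 2) / (2 * ((n : ℝ) - 1))))
  rw [mul_one] at h
  exact h

theorem hasDerivAt_alphaD {n : ℕ} (hn : 3 ≤ n) {c x : ℝ} (hc : 0 < c) (hx : 0 < x) :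
    HasDerivAt (alphaD n c) (alphaD2 n c x) x := by
  have hr := radicand_pos hn hc hx
  have hs := Real.sqrt_pos.mpr hr
  have h := ((((hasDerivAt_id x).add_const (2 * ((n : ℝ) - 1) * c)).div
    (hasDerivAt_sqrt_radicand hn hc hx) hs.ne').const_mul
      (((n : ℝ) - 2) / (2 * ((n : ℝ) - 1)))).const_sub ((n : ℝ) / (2 * ((n : ℝ) - 1)))
  refine h.congr_deriv ?_
  rw [alphaD2, ← mul_neg]
  congr 1
  have hsq := Real.sq_sqrt hr.le
  set s := √(x ^ 2 + 4 * ((n : ℝ) - 1) * c * x)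
  simp only [id]
  field_simp
  rw [hsq]
  ring

theorem two_mul_alphaD2_add_alphaD {n : ℕ} (hn : 3 ≤ n) {c x : ℝ} (hc : 0 < c) (hx : 0 < x) :
    2 * x * alphaD2 n c x + alphaD n c x = (n : ℝ) / (2 * ((n : ℝ) - 1)) -
      (((n : ℝ) - 2) / (2 * ((n : ℝ) - 1))) * (x ^ 2 * (x + 6 * (((n : ℝ) - 1) * c)) /
        √(x ^ 2 + 4 * (((n : ℝ) - 1) * c) * x) ^ 3) := by
  have hr := radicand_pos hn hc hx
  have hs := Real.sqrt_pos.mpr hr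
  have hsq := Real.sq_sqrt hr.le
  rw [alphaD2, alphaD, ← mul_assoc 4]
  set s := √(x ^ 2 + 4 * ((n : ℝ) - 1) * c * x)
  have key : (x + 2 * ((n : ℝ) - 1) * c) / s - 2 * x * (4 * ((n : ℝ) - 1) ^ 2 * c ^ 2 / s ^ 3) =
      x ^ 2 * (x + 6 * (((n : ℝ) - 1) * c)) / s ^ 3 := by
    field_simp
    rw [hsq]
    ring
  rw [← key]
  ring

theorem sq_div_sqrt_pow_three {b x : ℝ} (hb : 0 < b) (hx : 0 < x) :
    (x ^ 2 * (x + 6 * b) / √(x ^ 2 + 4 * b * x) ^ 3) ^ 2 =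
      1 - 12 * (b / (x + 4 * b)) ^ 2 - 16 * (b / (x + 4 * b)) ^ 3 := by
  have h : 0 < x ^ 2 + 4 * b * x := by positivity
  have ht : 0 < x + 4 * b := by positivity
  rw [div_pow, ← pow_mul, show 3 * 2 = 2 * 3 from rfl, pow_mul √_, Real.sq_sqrt h.le,
    show x ^ 2 + 4 * b * x = x * (x + 4 * b) by ring]
  field_simp
  ring

theorem strictMonoOn_div_sqrt_pow_three {b : ℝ} (hb : 0 < b) :
    StrictMonoOn (fun x => x ^ 2 * (x + 6 * b) / √(x ^ 2 + 4 * b * x) ^ 3) (Ioi 0) := by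
  intro x hx y hy hxy
  simp only [mem_Ioi] at hx hy
  refine lt_of_pow_lt_pow_left₀ 2 (by positivity) ?_
  rw [sq_div_sqrt_pow_three hb hx, sq_div_sqrt_pow_three hb hy]
  have h : b / (y + 4 * b) < b / (x + 4 * b) := by gcongr
  have h0 : 0 < b / (y + 4 * b) := by positivity
  have h2 : (b / (y + 4 * b)) ^ 2 < (b / (x + 4 * b)) ^ 2 := by gcongr
  have h3 : (b / (y + 4 * b)) ^ 3 < (b / (x + 4 * b)) ^ 3 := by gcongr
  linarith

theorem yn_add_pos_and_cubic {n : ℕ} (hn : 3 ≤ n) :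
    0 < yn n + 4 * ((n : ℝ) - 1) ∧
      (2 * (n : ℝ) - 5) * (yn n + 4 * ((n : ℝ) - 1)) ^ 3 =
        ((n : ℝ) ^ 2 - 4) ^ 2 * (3 * (yn n + 4 * ((n : ℝ) - 1)) + 4 * ((n : ℝ) - 1)) := by
  have hN : (3 : ℝ) ≤ n := by exact_mod_cast hn
  rw [yn]
  generalize (n : ℝ) = N at hN
  have h5 : 0 < 2 * N - 5 := by linarith
  have hs := Real.sqrt_pos.mpr h5
  have hsq := Real.sq_sqrt h5.le
  set s := √(2 * N - 5)
  have hk : 0 < N - 1 := by linarith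
  have hM : 0 < N ^ 2 - 4 := by nlinarith
  have hA : 0 < N ^ 2 - 4 * N + 6 := by nlinarith [sq_nonneg (N - 2)]
  set φ := Real.arctan ((N ^ 2 - 4 * N + 6) / (2 * (N - 1) * s)) with hφ
  have hφ1 : φ < π / 2 := Real.arctan_lt_pi_div_two _
  have hφ0 : 0 < φ := Real.arctan_pos.mpr (by positivity)
  have hcos : Real.cos φ = 2 * (N - 1) * s / (N ^ 2 - 4) := by
    have e : 1 + ((N ^ 2 - 4 * N + 6) / (2 * (N - 1) * s)) ^ 2 =
        ((N ^ 2 - 4) / (2 * (N - 1) * s)) ^ 2 := by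
      field_simp
      rw [hsq]
      ring
    rw [hφ, Real.cos_arctan, e, Real.sqrt_sq (by positivity), one_div_div]
  have hC : 0 < Real.cos (1 / 3 * φ) :=
    Real.cos_pos_of_mem_Ioo ⟨by linarith, by linarith⟩
  have h3 := Real.cos_three_mul (1 / 3 * φ)
  rw [show 3 * (1 / 3 * φ) = φ by ring, hcos] at h3
  set C := Real.cos (1 / 3 * φ)
  have e : 4 * (1 - N) + 2 * (N ^ 2 - 4) / s * C + 4 * (N - 1) = 2 * (N ^ 2 - 4) / s * C := by
    ring
  rw [e]
  refine ⟨by positivity, ?_⟩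
  rw [← hsq]
  rw [div_eq_iff hM.ne'] at h3
  field_simp
  linear_combination (-2) * h3

theorem yn_pos {n : ℕ} (hn : 3 ≤ n) : 0 < yn n := by
  have hN : (3 : ℝ) ≤ n := by exact_mod_cast hn
  obtain ⟨ht, h⟩ := yn_add_pos_and_cubic hn
  generalize (n : ℝ) = N at *
  by_contra! hy
  set t := yn n + 4 * (N - 1) with ht'
  have htk : t ≤ 4 * (N - 1) := by linarith
  have h5 : 0 < 2 * N - 5 := by linarith
  have hk : 0 < N - 1 := by linarith
  have h1 : (2 * N - 5) * t ^ 3 ≤ (2 * N - 5) * (t * (4 * (N - 1)) ^ 2) := by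
    rw [pow_succ' t 2]
    gcongr
  have h2 : (N ^ 2 - 4) ^ 2 * (4 * t) ≤ (N ^ 2 - 4) ^ 2 * (3 * t + 4 * (N - 1)) := by
    gcongr
    linarith
  have hA : 0 < N ^ 2 - 4 * N + 6 := by nlinarith [sq_nonneg (N - 2)]
  have h3 : 0 < t * (N ^ 2 - 4 * N + 6) ^ 2 := by positivity
  nlinarith

theorem x0_pos {n : ℕ} (hn : 3 ≤ n) {c : ℝ} (hc : 0 < c) : 0 < x0 n c :=
  mul_pos (yn_pos hn) hc

theorem div_sqrt_pow_three_x0 {n : ℕ} (hn : 3 ≤ n) {c : ℝ} (hc : 0 < c) :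
    x0 n c ^ 2 * (x0 n c + 6 * (((n : ℝ) - 1) * c)) /
        √(x0 n c ^ 2 + 4 * (((n : ℝ) - 1) * c) * x0 n c) ^ 3 =
      ((n : ℝ) ^ 2 - 4 * n + 6) / ((n : ℝ) ^ 2 - 4) := by
  have hN : (3 : ℝ) ≤ n := by exact_mod_cast hn
  have hx : 0 < x0 n c := x0_pos hn hc
  obtain ⟨ht, h⟩ := yn_add_pos_and_cubic hn
  have hxt : x0 n c + 4 * (((n : ℝ) - 1) * c) = (yn n + 4 * ((n : ℝ) - 1)) * c := by
    rw [x0]; ring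
  have hk : 0 < (n : ℝ) - 1 := by linarith
  have hM : 0 < (n : ℝ) ^ 2 - 4 := by nlinarith
  have hA : 0 < (n : ℝ) ^ 2 - 4 * n + 6 := by nlinarith [sq_nonneg ((n : ℝ) - 2)]
  rw [← sq_eq_sq₀ (by positivity) (by positivity), sq_div_sqrt_pow_three (by positivity) hx, hxt,
    mul_div_mul_right _ _ hc.ne']
  generalize (n : ℝ) = N at *
  generalize yn n + 4 * (N - 1) = t at *
  field_simp
  linear_combination (4 * (N - 1) ^ 2) * h

theorem gamma_expr_x0 {n : ℕ} (hn : 3 ≤ n) {c : ℝ} (hc : 0 < c) :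
    2 * x0 n c * alphaD2 n c (x0 n c) + alphaD n c (x0 n c) = 3 / ((n : ℝ) + 2) := by
  have hN : (3 : ℝ) ≤ n := by exact_mod_cast hn
  rw [two_mul_alphaD2_add_alphaD hn hc (x0_pos hn hc), div_sqrt_pow_three_x0 hn hc]
  have h1 : (n : ℝ) - 1 ≠ 0 := by linarith
  have h2 : (n : ℝ) - 2 ≠ 0 := by linarith
  have h3 : (n : ℝ) + 2 ≠ 0 := by linarith
  rw [show (n : ℝ) ^ 2 - 4 = (n - 2) * (n + 2) by ring]
  field_simp
  ring

theorem strictAntiOn_two_mul_alphaD2_add_alphaD {n : ℕ} (hn : 3 ≤ n) {c : ℝ} (hc : 0 < c) :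
    StrictAntiOn (fun x => 2 * x * alphaD2 n c x + alphaD n c x) (Ioi 0) := by
  have hN : (3 : ℝ) ≤ n := by exact_mod_cast hn
  have h1 : 0 < (n : ℝ) - 1 := by linarith
  have h2 : 0 < (n : ℝ) - 2 := by linarith
  intro x hx y hy hxy
  have h := strictMonoOn_div_sqrt_pow_three (mul_pos h1 hc) hx hy hxy
  simp only [two_mul_alphaD2_add_alphaD hn hc hx, two_mul_alphaD2_add_alphaD hn hc hy]
  gcongr

theorem betaF_eq {n : ℕ} (hn : 3 ≤ n) {c : ℝ} (hc : 0 < c) (x : ℝ) :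
    betaF n c x = alphaF n c (x0 n c) + alphaD n c (x0 n c) * (x - x0 n c)
      + (1 / 2) * alphaD2 n c (x0 n c) * (x - x0 n c) ^ 2 := by
  have hx : 0 < x0 n c := x0_pos hn hc
  have h : deriv (alphaF n c) =ᶠ[𝓝 (x0 n c)] alphaD n c := by
    filter_upwards [Ioi_mem_nhds hx] with y hy
    exact (hasDerivAt_alphaF hn hc hy).deriv
  rw [betaF, h.deriv_eq, h.eq_of_nhds, (hasDerivAt_alphaD hn hc hx).deriv]

/-- The derivative of `β`. -/
noncomputable def betaD (n : ℕ) (c x : ℝ) : ℝ :=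
  alphaD n c (x0 n c) + alphaD2 n c (x0 n c) * (x - x0 n c)

theorem hasDerivAt_betaF {n : ℕ} (hn : 3 ≤ n) {c : ℝ} (hc : 0 < c) (x : ℝ) :
    HasDerivAt (betaF n c) (betaD n c x) x := by
  rw [funext (betaF_eq hn hc)]
  have h := (hasDerivAt_id x).sub_const (x0 n c)
  have h' := ((h.const_mul (alphaD n c (x0 n c))).const_add (alphaF n c (x0 n c))).add
    ((h.pow 2).const_mul (1 / 2 * alphaD2 n c (x0 n c)))
  refine h'.congr_deriv ?_
  simp only [betaD, id]
  push_cast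
  ring

theorem hasDerivAt_betaD (n : ℕ) (c x : ℝ) :
    HasDerivAt (betaD n c) (alphaD2 n c (x0 n c)) x := by
  have h := (((hasDerivAt_id x).sub_const (x0 n c)).const_mul
    (alphaD2 n c (x0 n c))).const_add (alphaD n c (x0 n c))
  rw [mul_one] at h
  exact h

theorem gammaF'_eq {n : ℕ} (hn : 3 ≤ n) {c : ℝ} (hc : 0 < c) {x : ℝ} (hx : 0 ≤ x) :
    gammaF' n c x = if x0 n c ≤ x then alphaD n c x else betaD n c x := by
  have h0 : 0 < x0 n c := x0_pos hn hc
  have h : HasDerivAt (gammaF n c) _ x := hasDerivAt_ite_le (a := x0 n c)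
    (fun y hy => hasDerivAt_alphaF hn hc (h0.trans_le hy)) (fun y _ => hasDerivAt_betaF hn hc y)
    (by simp [betaF]) (by simp [betaD]) x
  exact h.hasDerivWithinAt.derivWithin (uniqueDiffOn_Ici 0 x hx)

theorem gammaF''_eq {n : ℕ} (hn : 3 ≤ n) {c : ℝ} (hc : 0 < c) {x : ℝ} (hx : 0 ≤ x) :
    gammaF'' n c x = if x0 n c ≤ x then alphaD2 n c x else alphaD2 n c (x0 n c) := by
  have h0 : 0 < x0 n c := x0_pos hn hc
  have h := hasDerivAt_ite_le (a := x0 n c)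
    (fun y hy => hasDerivAt_alphaD hn hc (h0.trans_le hy)) (fun y _ => hasDerivAt_betaD n c y)
    (by simp [betaD]) rfl x
  exact (h.hasDerivWithinAt.congr (fun y hy => gammaF'_eq hn hc hy)
    (gammaF'_eq hn hc hx)).derivWithin (uniqueDiffOn_Ici 0 x hx)

theorem stmt_3 (n : ℕ) (hn : 3 ≤ n) (c : ℝ) (hc : 0 < c) (x : ℝ) (hx : 0 ≤ x) :
    2 * x * gammaF'' n c x + gammaF' n c x ≤ 3 / ((n : ℝ) + 2) ∧
    (2 * x * gammaF'' n c x + gammaF' n c x = 3 / ((n : ℝ) + 2) ↔ x = x0 n c) := by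
  have h0 : 0 < x0 n c := x0_pos hn hc
  have hE := gamma_expr_x0 hn hc
  rw [gammaF'_eq hn hc hx, gammaF''_eq hn hc hx]
  rcases lt_trichotomy x (x0 n c) with h | rfl | h
  · have hlt : 2 * x * alphaD2 n c (x0 n c) + betaD n c x < 3 / ((n : ℝ) + 2) := by
      have hN : (3 : ℝ) ≤ n := by exact_mod_cast hn
      have h1 : 0 < (n : ℝ) - 1 := by linarith
      have h2 : 0 < (n : ℝ) - 2 := by linarith
      have hpos : 0 < alphaD2 n c (x0 n c) := by
        have := Real.sqrt_pos.mpr (radicand_pos hn hc h0)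
        rw [alphaD2]
        positivity
      rw [betaD, ← hE]
      nlinarith [mul_pos hpos (sub_pos.mpr h)]
    simp only [if_neg h.not_ge]
    exact ⟨hlt.le, iff_of_false hlt.ne h.ne⟩
  · rw [if_pos le_rfl, if_pos le_rfl]
    exact ⟨hE.le, iff_of_true hE rfl⟩
  · have hlt := strictAntiOn_two_mul_alphaD2_add_alphaD hn hc h0 (h0.trans h) h
    simp only [hE] at hlt
    simp only [if_pos h.le]
    exact ⟨hlt.le, iff_of_false hlt.ne h.ne'⟩
end

section
/- For n = 10, one has k_{10} = 6, i.e. α₁(y_{10}) − α₁'(y_{10})²/(2·α₁''(y_{10})) = 6. -/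
open Real Filter

lemma cos_third_arctan :
    Real.cos ((1 / 3) * Real.arctan (11 / (3 * √15))) = √15 / 4 := by
  have hs : √(15 : ℝ) ^ 2 = 15 := Real.sq_sqrt (by norm_num)
  have hs0 : 0 < √(15 : ℝ) := by positivity
  set φ := Real.arctan (11 / (3 * √15)) with hφ
  have hcos : Real.cos φ = 3 * √15 / 16 := by
    have hsq : (1 : ℝ) + (11 / (3 * √15)) ^ 2 = (16 / (3 * √15)) ^ 2 := by
      field_simp
      rw [hs]
      norm_num
    rw [hφ, Real.cos_arctan, hsq, Real.sqrt_sq (by positivity), one_div_div]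
  have hpos : 0 < Real.cos ((1 / 3) * φ) := by
    apply Real.cos_pos_of_mem_Ioo
    have h₁ := Real.neg_pi_div_two_lt_arctan (11 / (3 * √15))
    have h₂ := Real.arctan_lt_pi_div_two (11 / (3 * √15))
    constructor <;> linarith [Real.pi_pos]
  have htriple := Real.cos_three_mul ((1 / 3) * φ)
  rw [show 3 * ((1 / 3) * φ) = φ by ring, hcos] at htriple
  set c := Real.cos ((1 / 3) * φ)
  have hfactor : (c - √15 / 4) * (4 * c ^ 2 + c * √15 + 3 / 4) = 0 := by
    linear_combination -htriple - c / 4 * hs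
  rcases mul_eq_zero.mp hfactor with h | h
  · linarith
  · nlinarith [mul_pos hpos hs0]

lemma yn_ten : yn 10 = 12 := by
  have harg : (((10 : ℕ) : ℝ) ^ 2 - 4 * ((10 : ℕ) : ℝ) + 6) /
      (2 * (((10 : ℕ) : ℝ) - 1) * √(2 * ((10 : ℕ) : ℝ) - 5)) = 11 / (3 * √15) := by
    rw [show 2 * ((10 : ℕ) : ℝ) - 5 = 15 by norm_num]
    push_cast
    field_simp
    norm_num
  rw [yn, harg, cos_third_arctan, show 2 * ((10 : ℕ) : ℝ) - 5 = 15 by norm_num]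
  push_cast
  field_simp
  norm_num

lemma sqrt_twelve_radicand : √((12 : ℝ) ^ 2 + 36 * 12) = 24 := by
  rw [show (12 : ℝ) ^ 2 + 36 * 12 = 24 ^ 2 by norm_num]
  exact Real.sqrt_sq (by norm_num)

lemma alphaF_ten_one :
    alphaF 10 1 = fun x => 10 + 5 / 9 * x - 4 / 9 * √(x ^ 2 + 36 * x) := by
  funext x
  norm_num [alphaF]

lemma deriv_alphaF_ten_one_twelve : deriv (alphaF 10 1) 12 = 0 := by
  rw [alphaF_ten_one]
  have hrad : HasDerivAt (fun x : ℝ => x ^ 2 + 36 * x) 60 12 := by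
    refine ((hasDerivAt_pow 2 (12 : ℝ)).add
      ((hasDerivAt_id (12 : ℝ)).const_mul 36)).congr_deriv ?_
    norm_num
  have h := (((hasDerivAt_id (12 : ℝ)).const_mul (5 / 9)).const_add 10).sub
    ((hrad.sqrt (by norm_num)).const_mul (4 / 9))
  rw [sqrt_twelve_radicand] at h
  refine h.deriv.trans ?_
  norm_num

theorem stmt_12 :
    alphaF 10 1 (yn 10) -
        (deriv (alphaF 10 1) (yn 10)) ^ 2 / (2 * deriv (deriv (alphaF 10 1)) (yn 10)) = 6 := by
  rw [yn_ten, deriv_alphaF_ten_one_twelve]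
  simp only [alphaF_ten_one, sqrt_twelve_radicand]
  norm_num
end
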